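/- Entropy of averaged codewords in a serial/random access code (the Claim in Section 4.4): In the setting of an (n,m,p)-serial encoding as above (f mapping {0,1}^n to density matrices on ℂ^{2^m}, POVM elements E_{i,s} recovering bit i with probability ≥ p given suffix s, and 1/2 ≤ p ≤ 1), for every 0 ≤ k ≤ n and every y ∈ {0,1}^k, the density matrix ρ_y = 2^{−(n−k)} Σ_{z ∈ {0,1}^{n−k}} f(zy) (where zy denotes the concatenation of z followed by y, so y is the suffix of the encoded string) satisfies S(ρ_y) ≥ (1 − H(p))·(n − k). -/

import Mathlib

open Matrix
open scoped ComplexOrder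

/-- The von Neumann entropy (in bits) of a matrix: `S(ρ) = −Σᵢ λᵢ log₂ λᵢ` where
the `λᵢ` are the eigenvalues of `ρ` (defined to be `0` on non-Hermitian matrices). -/
noncomputable def vnEntropy {d : ℕ} (ρ : Matrix (Fin d) (Fin d) ℂ) : ℝ :=
  if h : ρ.IsHermitian then -∑ i, h.eigenvalues i * Real.logb 2 (h.eigenvalues i) else 0

/-- The binary entropy function `H(p) = −p log₂ p − (1−p) log₂ (1−p)`. -/
noncomputable def binH (p : ℝ) : ℝ :=
  -(p * Real.logb 2 p) - (1 - p) * Real.logb 2 (1 - p)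

/-- A density matrix: positive semidefinite (hence Hermitian) of unit trace. -/
def IsDensityMatrix {d : ℕ} (ρ : Matrix (Fin d) (Fin d) ℂ) : Prop :=
  ρ.PosSemidef ∧ ρ.trace = 1

/-- The suffix `x_{i+1} ⋯ x_n` (of length `n − 1 − i` in 0-indexed terms) of a
string `x ∈ {0,1}^n` after position `i`. -/
def suffixAfter {n : ℕ} (x : Fin n → Bool) (i : Fin n) : Fin (n - 1 - i.val) → Bool :=
  fun j => x ⟨i.val + 1 + j.val, by have := j.isLt; have := i.isLt; omega⟩

/-- The concatenation `zy ∈ {0,1}^n` of a prefix `z ∈ {0,1}^{n−k}` and a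
suffix `y ∈ {0,1}^k` (for `k ≤ n`). -/
def concatBits {n k : ℕ} (hk : k ≤ n) (z : Fin (n - k) → Bool) (y : Fin k → Bool) :
    Fin n → Bool :=
  fun j => if h : j.val < n - k then z ⟨j.val, h⟩
           else y ⟨j.val - (n - k), by have := j.isLt; omega⟩

/-- The overlaps `|⟨uᵢ, vⱼ⟩|²` of the columns of two matrices. -/
noncomputable def overlap {d : ℕ} (U V : Matrix (Fin d) (Fin d) ℂ) (i j : Fin d) : ℝ :=
  Complex.normSq ((Uᴴ * V) i j)

lemma overlap_nonneg {d : ℕ} (U V : Matrix (Fin d) (Fin d) ℂ) (i j : Fin d) :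
    0 ≤ overlap U V i j := Complex.normSq_nonneg _

lemma trace_conjTranspose_mul_eq_sum {d : ℕ} (A B : Matrix (Fin d) (Fin d) ℂ) :
    (Aᴴ * B).trace = ∑ i, ∑ j, star (A i j) * B i j := by
  simp only [Matrix.trace, Matrix.diag, Matrix.mul_apply, conjTranspose_apply]
  exact Finset.sum_comm

/-- The diagonal matrix with the given real entries. -/
noncomputable def realDiag {d : ℕ} (l : Fin d → ℝ) : Matrix (Fin d) (Fin d) ℂ :=
  diagonal fun i => (l i : ℂ)

lemma sum_overlap_right {d : ℕ} {U V : Matrix (Fin d) (Fin d) ℂ} (hU : Uᴴ * U = 1)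
    (hV : V * Vᴴ = 1) (i : Fin d) : ∑ j, overlap U V i j = 1 := by
  have h : ((Uᴴ * V) * (Uᴴ * V)ᴴ) i i = 1 := by
    rw [conjTranspose_mul, conjTranspose_conjTranspose, Matrix.mul_assoc, ← Matrix.mul_assoc V,
      hV, Matrix.one_mul, hU, one_apply_eq]
  rw [Matrix.mul_apply] at h
  have := congrArg Complex.re h
  simpa [overlap, conjTranspose_apply, Complex.mul_conj, -Matrix.conjTranspose_mul] using this

lemma sum_overlap_mul {d : ℕ} {U V : Matrix (Fin d) (Fin d) ℂ} (l : Fin d → ℝ) (j : Fin d) :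
    ∑ i, overlap U V i j * l i = ((Vᴴ * (U * realDiag l * Uᴴ) * V) j j).re := by
  have h : Vᴴ * (U * realDiag l * Uᴴ) * V = (Uᴴ * V)ᴴ * (realDiag l * (Uᴴ * V)) := by
    rw [conjTranspose_mul, conjTranspose_conjTranspose]
    simp only [Matrix.mul_assoc]
  rw [h, Matrix.mul_apply, Complex.re_sum]
  refine Finset.sum_congr rfl fun i _ => ?_
  rw [realDiag, diagonal_mul, conjTranspose_apply, overlap, Complex.normSq_apply]
  simp
  ring

lemma sq_completion_le {l m s : ℝ} (hl : 0 ≤ l) (hm : 0 ≤ m) (hs0 : 0 < s) (hs1 : s < 1)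
    (y c : ℂ) :
    (1 - s) * (2 * (star y * c).re * (l - m) -
        ((1 - s) * m + s * l) * Complex.normSq y) ≤
      Complex.normSq c * (l * ((l - m) / ((1 - s) * m + s * l)) - (l - m)) := by
  have h1 : 0 < 1 - s := by linarith
  set w := (1 - s) * m + s * l with hw
  have hw0 : 0 ≤ w := by positivity
  rcases hw0.eq_or_lt with h | h
  · have hm0 : m = 0 := by nlinarith [mul_nonneg h1.le hm, mul_nonneg hs0.le hl]
    have hl0 : l = 0 := by nlinarith [mul_nonneg h1.le hm, mul_nonneg hs0.le hl]
    simp [← h, hm0, hl0]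
  · have e : l * ((l - m) / w) - (l - m) = (1 - s) * ((l - m) ^ 2 / w) := by
      field_simp
      rw [hw]; ring
    rw [e, mul_left_comm]
    refine mul_le_mul_of_nonneg_left ?_ h1.le
    rw [mul_div_assoc', le_div_iff₀ h]
    simp only [Complex.normSq_apply, Complex.mul_re, Complex.star_def, Complex.conj_re,
      Complex.conj_im]
    nlinarith [sq_nonneg (c.re * (l - m) - w * y.re), sq_nonneg (c.im * (l - m) - w * y.im)]

/-- The derivative at `s` of the interpolation `relEntPath`. -/
noncomputable def relEntPathDeriv {d : ℕ} (U V : Matrix (Fin d) (Fin d) ℂ) (l m : Fin d → ℝ)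
    (s : ℝ) : ℝ :=
  ∑ i, ∑ j, overlap U V i j *
    (l i * ((l i - m j) / ((1 - s) * m j + s * l i)) - (l i - m j))

/-- An interpolation whose increment from `s = 0` to `s = 1` is the relative entropy of
`U diag(l) Uᴴ` with respect to `V diag(m) Vᴴ`. -/
noncomputable def relEntPath {d : ℕ} (U V : Matrix (Fin d) (Fin d) ℂ) (l m : Fin d → ℝ)
    (s : ℝ) : ℝ :=
  ∑ i, ∑ j, overlap U V i j *
    (l i * Real.log ((1 - s) * m j + s * l i) - s * (l i - m j))

lemma variational_le_relEntPathDeriv {d : ℕ} {U V : Matrix (Fin d) (Fin d) ℂ}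
    (hU : U * Uᴴ = 1) (hV : V * Vᴴ = 1) {l m : Fin d → ℝ}
    (hl : ∀ i, 0 ≤ l i) (hm : ∀ j, 0 ≤ m j) {X : Matrix (Fin d) (Fin d) ℂ} (hX : X.IsHermitian)
    {s : ℝ} (hs0 : 0 < s) (hs1 : s < 1) :
    (1 - s) * (2 * (X * (U * realDiag l * Uᴴ)).trace.re - 2 * (X * (V * realDiag m * Vᴴ)).trace.re
      - s * (X * X * (U * realDiag l * Uᴴ)).trace.re
      - (1 - s) * (X * X * (V * realDiag m * Vᴴ)).trace.re) ≤ relEntPathDeriv U V l m s := by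
  have hV' : Vᴴ * V = 1 := mul_eq_one_comm.mp hV
  set Y := Uᴴ * X * V with hY
  set C := Uᴴ * V with hC
  have hYc : Yᴴ = Vᴴ * X * U := by
    rw [hY, conjTranspose_mul, conjTranspose_mul, conjTranspose_conjTranspose, hX.eq,
      Matrix.mul_assoc]
  have cancelU : ∀ A : Matrix (Fin d) (Fin d) ℂ, U * (Uᴴ * A) = A := fun A => by
    rw [← Matrix.mul_assoc, hU, Matrix.one_mul]
  have cancelV : ∀ A : Matrix (Fin d) (Fin d) ℂ, V * (Vᴴ * A) = A := fun A => by
    rw [← Matrix.mul_assoc, hV, Matrix.one_mul]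
  have t1 : (X * (U * realDiag l * Uᴴ)).trace = (Yᴴ * (realDiag l * C)).trace := by
    rw [hYc, hC, Matrix.mul_assoc Vᴴ, Matrix.mul_assoc Vᴴ, trace_mul_comm Vᴴ]
    simp only [Matrix.mul_assoc, hV, Matrix.mul_one]
  have t2 : (X * (V * realDiag m * Vᴴ)).trace = (Yᴴ * (C * realDiag m)).trace := by
    rw [hYc, hC, Matrix.mul_assoc Vᴴ, Matrix.mul_assoc Vᴴ, trace_mul_comm Vᴴ]
    simp only [Matrix.mul_assoc, cancelU]
  have t3 : (X * X * (U * realDiag l * Uᴴ)).trace = (Yᴴ * (realDiag l * Y)).trace := by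
    rw [hYc, hY, Matrix.mul_assoc Vᴴ, Matrix.mul_assoc Vᴴ, trace_mul_comm Vᴴ, Matrix.mul_assoc X X,
      trace_mul_comm X]
    simp only [Matrix.mul_assoc, hV, Matrix.mul_one]
  have t4 : (X * X * (V * realDiag m * Vᴴ)).trace = (Yᴴ * (Y * realDiag m)).trace := by
    rw [hYc, hY, Matrix.mul_assoc Vᴴ, Matrix.mul_assoc Vᴴ, trace_mul_comm Vᴴ]
    simp only [Matrix.mul_assoc, cancelU]
  rw [t1, t2, t3, t4]
  simp only [trace_conjTranspose_mul_eq_sum, Complex.re_sum, Finset.mul_sum,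
    ← Finset.sum_sub_distrib, relEntPathDeriv]
  refine Finset.sum_le_sum fun i _ => Finset.sum_le_sum fun j _ => ?_
  refine le_trans (le_of_eq ?_) (sq_completion_le (hl i) (hm j) hs0 hs1 (Y i j) (C i j))
  simp only [realDiag, diagonal_mul, mul_diagonal, Complex.normSq_apply, Complex.mul_re,
    Complex.mul_im, Complex.star_def, Complex.conj_re, Complex.conj_im, Complex.ofReal_re,
    Complex.ofReal_im]
  ring

lemma relEntPath_continuousOn {d : ℕ} {U V : Matrix (Fin d) (Fin d) ℂ} {l m : Fin d → ℝ}
    (hl : ∀ i, 0 ≤ l i) (hm : ∀ j, 0 ≤ m j)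
    (hsupp : ∀ i j, m j = 0 → overlap U V i j * l i = 0) :
    ContinuousOn (relEntPath U V l m) (Set.Icc 0 1) := by
  unfold relEntPath
  refine continuousOn_finsetSum _ fun i _ => continuousOn_finsetSum _ fun j _ => ?_
  simp only [mul_sub, ← mul_assoc]
  refine ContinuousOn.sub ?_ (by fun_prop)
  by_cases h0 : overlap U V i j * l i = 0
  · simp only [h0, zero_mul]; exact continuousOn_const
  · have hmj : 0 < m j := (hm j).lt_of_ne' fun h => h0 (hsupp i j h)
    have hli : 0 < l i := (hl i).lt_of_ne' fun h => h0 (by rw [h, mul_zero])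
    refine continuousOn_const.mul (ContinuousOn.log (by fun_prop) fun s hs => ?_)
    rcases hs.1.eq_or_lt with rfl | h
    · simp [hmj.ne']
    · have := mul_nonneg (sub_nonneg.mpr hs.2) hmj.le
      have := mul_pos h hli
      linarith

lemma relEntPath_hasDerivAt {d : ℕ} {U V : Matrix (Fin d) (Fin d) ℂ} {l m : Fin d → ℝ}
    (hl : ∀ i, 0 ≤ l i) (hm : ∀ j, 0 ≤ m j)
    {s : ℝ} (hs0 : 0 < s) (hs1 : s < 1) :
    HasDerivAt (relEntPath U V l m) (relEntPathDeriv U V l m s) s := by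
  unfold relEntPath relEntPathDeriv
  refine HasDerivAt.fun_sum fun i _ => HasDerivAt.fun_sum fun j _ => ?_
  refine HasDerivAt.const_mul _ ?_
  have hlin : HasDerivAt (fun s : ℝ => s * (l i - m j)) (l i - m j) s := by
    simpa using (hasDerivAt_id s).mul_const (l i - m j)
  refine HasDerivAt.sub ?_ hlin
  rcases (hl i).eq_or_lt with h | h
  · simp only [← h, zero_mul]; exact hasDerivAt_const _ _
  · refine HasDerivAt.const_mul _ (HasDerivAt.log ?_ ?_)
    · have := hlin.const_add (m j)
      refine this.congr_of_eventuallyEq (Filter.Eventually.of_forall fun t => ?_)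
      simp only; ring
    · have := mul_nonneg (sub_nonneg.mpr hs1.le) (hm j)
      have := mul_pos hs0 h
      linarith

lemma sum_overlap_left {d : ℕ} {U V : Matrix (Fin d) (Fin d) ℂ} (hU : U * Uᴴ = 1)
    (hV : Vᴴ * V = 1) (j : Fin d) : ∑ i, overlap U V i j = 1 := by
  rw [← sum_overlap_right hV hU j]
  refine Finset.sum_congr rfl fun i _ => ?_
  have h : Vᴴ * U = (Uᴴ * V)ᴴ := by rw [conjTranspose_mul, conjTranspose_conjTranspose]
  rw [overlap, overlap, h, conjTranspose_apply, Complex.star_def, Complex.normSq_conj]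

lemma relEntPath_one_sub_zero {d : ℕ} {U V : Matrix (Fin d) (Fin d) ℂ} (hU : U * Uᴴ = 1)
    (hV : V * Vᴴ = 1) {l m : Fin d → ℝ} (hlm : ∑ i, l i = ∑ j, m j) :
    relEntPath U V l m 1 - relEntPath U V l m 0 =
      ∑ i, l i * Real.log (l i) -
        ∑ j, Real.log (m j) * ((Vᴴ * (U * realDiag l * Uᴴ) * V) j j).re := by
  have e : relEntPath U V l m 1 - relEntPath U V l m 0 =
      ∑ i, ∑ j, overlap U V i j * (l i * Real.log (l i)) -
      ∑ i, ∑ j, Real.log (m j) * (overlap U V i j * l i) -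
      (∑ i, ∑ j, overlap U V i j * l i - ∑ i, ∑ j, overlap U V i j * m j) := by
    simp only [relEntPath, ← Finset.sum_sub_distrib]
    refine Finset.sum_congr rfl fun i _ => Finset.sum_congr rfl fun j _ => ?_
    simp only [sub_self, zero_mul, one_mul, zero_add, sub_zero, add_zero]
    ring
  have r : ∀ g : Fin d → ℝ, ∑ i, ∑ j, overlap U V i j * g i = ∑ i, g i := fun g => by
    simp only [← Finset.sum_mul, sum_overlap_right (mul_eq_one_comm.mp hU) hV, one_mul]
  have c : ∑ i, ∑ j, overlap U V i j * m j = ∑ j, m j := by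
    rw [Finset.sum_comm]
    simp only [← Finset.sum_mul, sum_overlap_left hU (mul_eq_one_comm.mp hV), one_mul]
  rw [e, r fun i => l i * Real.log (l i), r l, c, hlm, sub_self, sub_zero, Finset.sum_comm]
  simp only [← Finset.mul_sum, sum_overlap_mul]

open scoped MatrixOrder in
lemma trace_mul_re_nonneg {d : ℕ} {A B : Matrix (Fin d) (Fin d) ℂ} (hA : A.PosSemidef)
    (hB : B.PosSemidef) : 0 ≤ (A * B).trace.re := by
  obtain ⟨C, rfl⟩ : ∃ C : Matrix (Fin d) (Fin d) ℂ, B = C * Cᴴ := by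
    obtain ⟨C, hC⟩ := (CStarAlgebra.nonneg_iff_eq_mul_star_self (a := B)).mp hB.nonneg
    exact ⟨C, hC⟩
  rw [← Matrix.mul_assoc, trace_mul_comm, ← Matrix.mul_assoc]
  exact (Complex.le_def.mp (hA.conjTranspose_mul_mul_same C).trace_nonneg).1

/-- The observable with value `a` on the effect `E` and value `b` on its complement. -/
noncomputable def twoValued {d : ℕ} (E : Matrix (Fin d) (Fin d) ℂ) (a b : ℝ) :
    Matrix (Fin d) (Fin d) ℂ :=
  (a : ℂ) • E + (b : ℂ) • (1 - E)

lemma twoValued_isHermitian {d : ℕ} {E : Matrix (Fin d) (Fin d) ℂ} (hE : E.IsHermitian)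
    (a b : ℝ) : (twoValued E a b).IsHermitian := by
  have h : (1 - E).IsHermitian := isHermitian_one.sub hE
  simp [IsHermitian, twoValued, conjTranspose_smul, hE.eq]

lemma trace_twoValued_mul {d : ℕ} (E : Matrix (Fin d) (Fin d) ℂ) (a b : ℝ)
    {σ : Matrix (Fin d) (Fin d) ℂ} (hσ : σ.trace = 1) :
    (twoValued E a b * σ).trace.re = a * (E * σ).trace.re + b * (1 - (E * σ).trace.re) := by
  simp [twoValued, Matrix.add_mul, Matrix.sub_mul, hσ]

lemma trace_twoValued_sq_mul_le {d : ℕ} {E : Matrix (Fin d) (Fin d) ℂ} (hE : E.PosSemidef)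
    (hE' : (1 - E).PosSemidef) (a b : ℝ)
    {σ : Matrix (Fin d) (Fin d) ℂ} (hσ : IsDensityMatrix σ) :
    (twoValued E a b * twoValued E a b * σ).trace.re ≤
      a ^ 2 * (E * σ).trace.re + b ^ 2 * (1 - (E * σ).trace.re) := by
  rw [← trace_twoValued_mul E (a ^ 2) (b ^ 2) hσ.2]
  have hP : (E - E * E).PosSemidef := by
    have h1 := hE'.conjTranspose_mul_mul_same E
    have h2 := hE.conjTranspose_mul_mul_same (1 - E)
    rw [hE.1.eq] at h1
    rw [hE'.1.eq] at h2
    have : E - E * E = E * (1 - E) * E + (1 - E) * E * (1 - E) := by noncomm_ring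
    rw [this]; exact h1.add h2
  have h := mul_nonneg (sq_nonneg (a - b)) (trace_mul_re_nonneg hP hσ.1)
  have e : twoValued E (a ^ 2) (b ^ 2) - twoValued E a b * twoValued E a b =
      (((a - b) ^ 2 : ℝ) : ℂ) • (E - E * E) := by
    simp only [twoValued, Matrix.mul_add, Matrix.add_mul, Matrix.mul_sub, Matrix.sub_mul,
      Matrix.mul_one, Matrix.one_mul, Matrix.smul_mul, Matrix.mul_smul, smul_sub]
    push_cast
    module
  rw [← sub_nonneg, ← Complex.sub_re, ← trace_sub, ← Matrix.sub_mul, e, Matrix.smul_mul,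
    trace_smul, smul_eq_mul, Complex.re_ofReal_mul]
  exact h

lemma measured_le_relEntPathDeriv {d : ℕ} {U V : Matrix (Fin d) (Fin d) ℂ}
    (hU : U * Uᴴ = 1) (hV : V * Vᴴ = 1) {l m : Fin d → ℝ}
    (hl : ∀ i, 0 ≤ l i) (hm : ∀ j, 0 ≤ m j)
    (hσ : IsDensityMatrix (U * realDiag l * Uᴴ)) (hρ : IsDensityMatrix (V * realDiag m * Vᴴ))
    {E : Matrix (Fin d) (Fin d) ℂ} (hE : E.PosSemidef) (hE' : (1 - E).PosSemidef) (a b : ℝ)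
    {s e r : ℝ} (hs0 : 0 < s) (hs1 : s < 1) (he : (E * (U * realDiag l * Uᴴ)).trace.re = e)
    (hr : (E * (V * realDiag m * Vᴴ)).trace.re = r) :
    (1 - s) * (2 * (a - b) * (e - r) - s * (a ^ 2 * e + b ^ 2 * (1 - e)) -
      (1 - s) * (a ^ 2 * r + b ^ 2 * (1 - r))) ≤ relEntPathDeriv U V l m s := by
  refine le_trans ?_ (variational_le_relEntPathDeriv hU hV hl hm
    (twoValued_isHermitian hE.1 a b) hs0 hs1)
  have h1 := trace_twoValued_sq_mul_le hE hE' a b hσ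
  have h2 := trace_twoValued_sq_mul_le hE hE' a b hρ
  have hs : 0 < 1 - s := sub_pos.mpr hs1
  refine mul_le_mul_of_nonneg_left ?_ hs.le
  rw [trace_twoValued_mul _ _ _ hσ.2, trace_twoValued_mul _ _ _ hρ.2, he, hr]
  rw [he] at h1
  rw [hr] at h2
  have h3 := mul_le_mul_of_nonneg_left h1 hs0.le
  have h4 := mul_le_mul_of_nonneg_left h2 hs.le
  linarith

/-- An interpolation whose increment from `s = 0` to `s = 1` is the relative entropy of the
Bernoulli distribution `(p, 1 - p)` with respect to the uniform one. -/
noncomputable def bernoulliPath (p s : ℝ) : ℝ :=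
  p * Real.log (1 / 2 + s * (p - 1 / 2)) + (1 - p) * Real.log (1 / 2 - s * (p - 1 / 2))

lemma bernoulliPath_continuousOn {p : ℝ} (hp : 1 / 2 ≤ p) (hp1 : p ≤ 1) :
    ContinuousOn (bernoulliPath p) (Set.Icc 0 1) := by
  unfold bernoulliPath
  refine ContinuousOn.add ?_ ?_
  · refine continuousOn_const.mul (ContinuousOn.log (by fun_prop) fun s hs => ?_)
    have := mul_nonneg hs.1 (sub_nonneg.mpr hp)
    linarith
  · rcases hp1.eq_or_lt with rfl | h
    · simp only [sub_self, zero_mul]; exact continuousOn_const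
    · refine continuousOn_const.mul (ContinuousOn.log (by fun_prop) fun s hs => ?_)
      have := mul_nonneg (sub_nonneg.mpr hs.2) (sub_nonneg.mpr hp)
      linarith

lemma half_sub_mul_pos {p s : ℝ} (hp1 : p ≤ 1) (hs0 : 0 < s) (hs1 : s < 1) :
    0 < 1 / 2 - s * (p - 1 / 2) := by
  nlinarith [mul_nonneg hs0.le (sub_nonneg.mpr hp1)]

lemma half_add_mul_pos {p s : ℝ} (hp : 1 / 2 ≤ p) (hs0 : 0 < s) :
    0 < 1 / 2 + s * (p - 1 / 2) := by
  linarith [mul_nonneg hs0.le (sub_nonneg.mpr hp)]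

lemma bernoulliPath_hasDerivAt {p s : ℝ} (hp : 1 / 2 ≤ p) (hp1 : p ≤ 1) (hs0 : 0 < s)
    (hs1 : s < 1) :
    HasDerivAt (bernoulliPath p)
      ((1 - s) * ((p - 1 / 2) ^ 2 / (1 / 2 + s * (p - 1 / 2)) +
        (p - 1 / 2) ^ 2 / (1 / 2 - s * (p - 1 / 2)))) s := by
  have h1 := half_add_mul_pos hp hs0
  have h2 := half_sub_mul_pos hp1 hs0 hs1
  have hlin : HasDerivAt (fun s : ℝ => s * (p - 1 / 2)) (p - 1 / 2) s := by
    simpa using (hasDerivAt_id s).mul_const (p - 1 / 2)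
  have := (((hlin.const_add (1 / 2)).log h1.ne').const_mul p).add
    (((hlin.const_sub (1 / 2)).log h2.ne').const_mul (1 - p))
  refine this.congr_deriv ?_
  have h1' := h1.ne'
  have h2' := h2.ne'
  generalize hu : 1 / 2 + s * (p - 1 / 2) = u at *
  generalize hv : 1 / 2 - s * (p - 1 / 2) = v at *
  have e1 : p = u + (1 - s) * (p - 1 / 2) := by rw [← hu]; ring
  have e2 : 1 - p = v - (1 - s) * (p - 1 / 2) := by rw [← hv]; ring
  rw [e2]
  nth_rewrite 1 [e1]
  field_simp
  ring

lemma bernoulliPath_one_sub_zero (p : ℝ) :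
    bernoulliPath p 1 - bernoulliPath p 0 = Real.log 2 * (1 - binH p) := by
  have h2 : Real.log 2 ≠ 0 := (Real.log_pos one_lt_two).ne'
  have e1 : (1 : ℝ) / 2 + (p - 1 / 2) = p := by ring
  have e2 : (1 : ℝ) / 2 - (p - 1 / 2) = 1 - p := by ring
  have e3 : Real.log (1 / 2) = -Real.log 2 := by rw [one_div, Real.log_inv]
  simp only [bernoulliPath, binH, Real.logb, one_mul, zero_mul, add_zero, sub_zero, e1, e2, e3]
  field_simp
  ring

/-- The derivative of `bernoulliPath` is dominated by the average of the two variational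
expressions in which the optimal observable for success probability `p` is used. -/
lemma bernoulliPath_deriv_le {p s e₁ e₀ : ℝ} (hp : 1 / 2 ≤ p) (hp1 : p ≤ 1) (hs0 : 0 < s)
    (hs1 : s < 1) (h₁ : p ≤ e₁) (h₀ : p ≤ 1 - e₀) {a b : ℝ}
    (ha : a = (p - 1 / 2) / (1 / 2 + s * (p - 1 / 2)))
    (hb : b = -((p - 1 / 2) / (1 / 2 - s * (p - 1 / 2)))) :
    (p - 1 / 2) ^ 2 / (1 / 2 + s * (p - 1 / 2)) + (p - 1 / 2) ^ 2 / (1 / 2 - s * (p - 1 / 2)) ≤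
      ((2 * (a - b) * (e₁ - (e₀ + e₁) / 2) - s * (a ^ 2 * e₁ + b ^ 2 * (1 - e₁)) -
        (1 - s) * (a ^ 2 * ((e₀ + e₁) / 2) + b ^ 2 * (1 - (e₀ + e₁) / 2))) +
      (2 * (b - a) * (e₀ - (e₀ + e₁) / 2) - s * (b ^ 2 * e₀ + a ^ 2 * (1 - e₀)) -
        (1 - s) * (b ^ 2 * ((e₀ + e₁) / 2) + a ^ 2 * (1 - (e₀ + e₁) / 2)))) / 2 := by
  have hu := half_add_mul_pos hp hs0
  have hv := half_sub_mul_pos hp1 hs0 hs1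
  have hd : 0 ≤ p - 1 / 2 := sub_nonneg.mpr hp
  have ha0 : 0 ≤ a := ha ▸ div_nonneg hd hu.le
  have hb0 : b ≤ 0 := by rw [hb]; exact neg_nonpos.mpr (div_nonneg hd hv.le)
  have hab : a + b ≤ 0 := by
    have : (p - 1 / 2) / (1 / 2 + s * (p - 1 / 2)) ≤ (p - 1 / 2) / (1 / 2 - s * (p - 1 / 2)) :=
      div_le_div_of_nonneg_left hd hv (by linarith [mul_nonneg hs0.le hd])
    rw [ha, hb]; linarith
  have hA : a * (1 / 2 + s * (p - 1 / 2)) = p - 1 / 2 := by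
    rw [ha]; exact div_mul_cancel₀ _ hu.ne'
  have hB : b * (1 / 2 - s * (p - 1 / 2)) = -(p - 1 / 2) := by
    rw [hb, neg_mul, div_mul_cancel₀ _ hv.ne']
  have e1 : (p - 1 / 2) ^ 2 / (1 / 2 + s * (p - 1 / 2)) = a * (p - 1 / 2) := by rw [ha]; ring
  have e2 : (p - 1 / 2) ^ 2 / (1 / 2 - s * (p - 1 / 2)) = -b * (p - 1 / 2) := by rw [hb]; ring
  rw [e1, e2]
  set t := (e₁ + (1 - e₀)) / 2 with ht
  have htp : 0 ≤ t - p := by rw [ht]; linarith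
  have key : 0 ≤ (t - p) * ((a - b) * (2 - s * (a + b))) := by
    refine mul_nonneg htp (mul_nonneg (by linarith) ?_)
    linarith [mul_nonneg hs0.le (neg_nonneg.mpr hab)]
  have hA2 : a ^ 2 * (1 / 2 + s * (p - 1 / 2)) = a * (p - 1 / 2) := by
    linear_combination a * hA
  have hB2 : b ^ 2 * (1 / 2 - s * (p - 1 / 2)) = -b * (p - 1 / 2) := by
    linear_combination b * hB
  have : e₁ = 2 * t - 1 + e₀ := by rw [ht]; ring
  rw [this]
  linarith
lemma exists_spectral_decomposition {d : ℕ} {A : Matrix (Fin d) (Fin d) ℂ}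
    (hA : IsDensityMatrix A) :
    ∃ (U : Matrix (Fin d) (Fin d) ℂ) (l : Fin d → ℝ), U * Uᴴ = 1 ∧ A = U * realDiag l * Uᴴ ∧
      (∀ i, 0 ≤ l i) ∧ ∑ i, l i = 1 ∧ ∑ i, l i * Real.log (l i) = -(Real.log 2 * vnEntropy A) := by
  have hH : A.IsHermitian := hA.1.1
  refine ⟨hH.eigenvectorUnitary, hH.eigenvalues, ?_, ?_, hA.1.eigenvalues_nonneg, ?_, ?_⟩
  · exact Unitary.coe_mul_star_self _
  · exact hH.spectral_theorem
  · have h := hH.trace_eq_sum_eigenvalues.symm.trans hA.2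
    simpa using congrArg Complex.re h
  · have h2 : Real.log 2 ≠ 0 := (Real.log_pos one_lt_two).ne'
    rw [vnEntropy, dif_pos hH, mul_neg, neg_neg, Finset.mul_sum]
    refine Finset.sum_congr rfl fun i _ => ?_
    rw [Real.logb]
    field_simp

lemma vnEntropy_nonneg {d : ℕ} {A : Matrix (Fin d) (Fin d) ℂ} (hA : IsDensityMatrix A) :
    0 ≤ vnEntropy A := by
  obtain ⟨U, l, -, -, hl, hs, he⟩ := exists_spectral_decomposition hA
  have h : ∑ i, l i * Real.log (l i) ≤ 0 := by
    refine Finset.sum_nonpos fun i _ => mul_nonpos_of_nonneg_of_nonpos (hl i) ?_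
    refine Real.log_nonpos (hl i) ?_
    rw [← hs]
    exact Finset.single_le_sum (fun j _ => hl j) (Finset.mem_univ i)
  have h2 : 0 < Real.log 2 := Real.log_pos one_lt_two
  rw [he, neg_nonpos] at h
  exact nonneg_of_mul_nonneg_right h h2

lemma IsDensityMatrix.midpoint {d : ℕ} {σ₀ σ₁ : Matrix (Fin d) (Fin d) ℂ}
    (h₀ : IsDensityMatrix σ₀) (h₁ : IsDensityMatrix σ₁) :
    IsDensityMatrix ((2 : ℂ)⁻¹ • (σ₀ + σ₁)) := by
  refine ⟨(h₀.1.add h₁.1).smul (by simp), ?_⟩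
  rw [trace_smul, trace_add, h₀.2, h₁.2, smul_eq_mul]
  norm_num

lemma midpoint_conj_diag_re {d : ℕ} {σ₀ σ₁ ρ V : Matrix (Fin d) (Fin d) ℂ} {m : Fin d → ℝ}
    (hV : Vᴴ * V = 1) (hρ : ρ = (2 : ℂ)⁻¹ • (σ₀ + σ₁)) (hVρ : ρ = V * realDiag m * Vᴴ)
    (j : Fin d) :
    ((Vᴴ * σ₀ * V) j j).re + ((Vᴴ * σ₁ * V) j j).re = 2 * m j := by
  have h : Vᴴ * σ₀ * V + Vᴴ * σ₁ * V = (2 : ℂ) • realDiag m := by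
    have e : σ₀ + σ₁ = (2 : ℂ) • ρ := by rw [hρ, smul_smul]; norm_num
    rw [← Matrix.add_mul, ← Matrix.mul_add, e, hVρ, Matrix.mul_smul, Matrix.smul_mul]
    congr 1
    have a : Vᴴ * (V * realDiag m * Vᴴ) * V = (Vᴴ * V) * realDiag m * (Vᴴ * V) := by
      simp only [Matrix.mul_assoc]
    rw [a, hV, Matrix.one_mul, Matrix.mul_one]
  have := congrArg Complex.re (congrFun (congrFun h j) j)
  simpa [realDiag] using this

lemma overlap_mul_eq_zero {d : ℕ} {U V : Matrix (Fin d) (Fin d) ℂ} {l : Fin d → ℝ}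
    (hl : ∀ i, 0 ≤ l i) {j : Fin d} (h : ((Vᴴ * (U * realDiag l * Uᴴ) * V) j j).re ≤ 0)
    (i : Fin d) : overlap U V i j * l i = 0 := by
  have h0 : ∀ i ∈ Finset.univ, 0 ≤ overlap U V i j * l i := fun i _ =>
    mul_nonneg (overlap_nonneg U V i j) (hl i)
  rw [← sum_overlap_mul] at h
  exact (Finset.sum_eq_zero_iff_of_nonneg h0).mp (le_antisymm h (Finset.sum_nonneg h0)) i
    (Finset.mem_univ i)

/-- If an effect distinguishes two equiprobable states with success probability at least `p` for
each, then mixing them increases the average entropy by at least `1 - H(p)`. -/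
theorem vnEntropy_midpoint_ge {d : ℕ} {p : ℝ} (hp : 1 / 2 ≤ p) (hp1 : p ≤ 1)
    {σ₀ σ₁ E : Matrix (Fin d) (Fin d) ℂ} (h₀ : IsDensityMatrix σ₀) (h₁ : IsDensityMatrix σ₁)
    (hE : E.PosSemidef) (hE' : (1 - E).PosSemidef)
    (hE₁ : p ≤ (E * σ₁).trace.re) (hE₀ : p ≤ ((1 - E) * σ₀).trace.re) :
    (vnEntropy σ₀ + vnEntropy σ₁) / 2 + (1 - binH p) ≤
      vnEntropy ((2 : ℂ)⁻¹ • (σ₀ + σ₁)) := by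
  have hρd := h₀.midpoint h₁
  obtain ⟨ρ, hρ⟩ : ∃ ρ, ρ = (2 : ℂ)⁻¹ • (σ₀ + σ₁) := ⟨_, rfl⟩
  rw [← hρ] at hρd ⊢
  have htr : (E * ρ).trace.re = ((E * σ₀).trace.re + (E * σ₁).trace.re) / 2 := by
    rw [hρ, Matrix.mul_smul, trace_smul, Matrix.mul_add, trace_add, smul_eq_mul,
      show (2 : ℂ)⁻¹ = ((2⁻¹ : ℝ) : ℂ) by push_cast; rfl, Complex.re_ofReal_mul, Complex.add_re]
    ring
  have hE₀' : p ≤ 1 - (E * σ₀).trace.re := by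
    rwa [Matrix.sub_mul, Matrix.one_mul, trace_sub, h₀.2, Complex.sub_re, Complex.one_re] at hE₀
  obtain ⟨V, m, hV, hVρ, hm, hms, hmS⟩ := exists_spectral_decomposition hρd
  have hV' : Vᴴ * V = 1 := mul_eq_one_comm.mp hV
  have hdiag := midpoint_conj_diag_re hV' hρ hVρ
  have hnn : ∀ {σ : Matrix (Fin d) (Fin d) ℂ}, IsDensityMatrix σ → ∀ j,
      0 ≤ ((Vᴴ * σ * V) j j).re := fun h j =>
    (Complex.le_def.mp (h.1.conjTranspose_mul_mul_same V).diag_nonneg).1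
  have hn₀ := hnn h₀
  have hn₁ := hnn h₁
  clear hρ hnn
  obtain ⟨U₀, l₀, hU₀, hUσ₀, hl₀, hls₀, hlS₀⟩ := exists_spectral_decomposition h₀
  obtain ⟨U₁, l₁, hU₁, hUσ₁, hl₁, hls₁, hlS₁⟩ := exists_spectral_decomposition h₁
  have hs₀ : ∀ i j, m j = 0 → overlap U₀ V i j * l₀ i = 0 := fun i j hj =>
    overlap_mul_eq_zero hl₀ (by rw [← hUσ₀]; linarith [hdiag j, hn₁ j]) i
  have hs₁ : ∀ i j, m j = 0 → overlap U₁ V i j * l₁ i = 0 := fun i j hj =>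
    overlap_mul_eq_zero hl₁ (by rw [← hUσ₁]; linarith [hdiag j, hn₀ j]) i
  have hmono : MonotoneOn (fun s => (relEntPath U₁ V l₁ m s + relEntPath U₀ V l₀ m s) / 2 -
      bernoulliPath p s) (Set.Icc 0 1) := by
    refine monotoneOn_of_hasDerivWithinAt_nonneg
      (f' := fun s => (relEntPathDeriv U₁ V l₁ m s + relEntPathDeriv U₀ V l₀ m s) / 2 -
        (1 - s) * ((p - 1 / 2) ^ 2 / (1 / 2 + s * (p - 1 / 2)) +
        (p - 1 / 2) ^ 2 / (1 / 2 - s * (p - 1 / 2)))) (convex_Icc 0 1) ?_ ?_ ?_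
    · exact (((relEntPath_continuousOn hl₁ hm hs₁).add
        (relEntPath_continuousOn hl₀ hm hs₀)).div_const 2).sub (bernoulliPath_continuousOn hp hp1)
    · intro s hs
      rw [interior_Icc] at hs
      exact ((((relEntPath_hasDerivAt hl₁ hm hs.1 hs.2).add
        (relEntPath_hasDerivAt hl₀ hm hs.1 hs.2)).div_const 2).sub
        (bernoulliPath_hasDerivAt hp hp1 hs.1 hs.2)).hasDerivWithinAt
    · intro s hs
      rw [interior_Icc] at hs
      have hc := mul_le_mul_of_nonneg_left
        (bernoulliPath_deriv_le hp hp1 hs.1 hs.2 hE₁ hE₀' rfl rfl) (sub_nonneg.mpr hs.2.le)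
      generalize (p - 1 / 2) / (1 / 2 + s * (p - 1 / 2)) = a at hc
      generalize -((p - 1 / 2) / (1 / 2 - s * (p - 1 / 2))) = b at hc
      have hq₁ := measured_le_relEntPathDeriv hU₁ hV hl₁ hm (hUσ₁ ▸ h₁) (hVρ ▸ hρd) hE hE' a b
        hs.1 hs.2 (by rw [← hUσ₁]) (hVρ ▸ htr)
      have hq₀ := measured_le_relEntPathDeriv hU₀ hV hl₀ hm (hUσ₀ ▸ h₀) (hVρ ▸ hρd) hE hE' b a
        hs.1 hs.2 (by rw [← hUσ₀]) (hVρ ▸ htr)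
      rw [sub_nonneg]
      refine hc.trans ?_
      rw [mul_div_assoc', mul_add]
      linarith
  have h01 := hmono (Set.left_mem_Icc.mpr zero_le_one) (Set.right_mem_Icc.mpr zero_le_one)
    zero_le_one
  have hb := bernoulliPath_one_sub_zero p
  have hr₁ := relEntPath_one_sub_zero hU₁ hV (hls₁.trans hms.symm)
  have hr₀ := relEntPath_one_sub_zero hU₀ hV (hls₀.trans hms.symm)
  rw [← hUσ₁, hlS₁] at hr₁
  rw [← hUσ₀, hlS₀] at hr₀
  have hsum : ∑ j, Real.log (m j) * ((Vᴴ * σ₀ * V) j j).re +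
      ∑ j, Real.log (m j) * ((Vᴴ * σ₁ * V) j j).re = 2 * -(Real.log 2 * vnEntropy ρ) := by
    rw [← hmS, ← Finset.sum_add_distrib, Finset.mul_sum]
    refine Finset.sum_congr rfl fun j _ => ?_
    rw [← mul_add, hdiag]; ring
  simp only at h01
  refine le_of_mul_le_mul_left ?_ (Real.log_pos one_lt_two)
  linarith

/-- The string `x` with its first `r` bits replaced by `z`. -/
def replacePrefix {n : ℕ} (r : ℕ) (z : Fin r → Bool) (x : Fin n → Bool) : Fin n → Bool :=
  fun j => if h : j.val < r then z ⟨j.val, h⟩ else x j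

lemma replacePrefix_snoc {n r : ℕ} (hr : r < n) (z : Fin r → Bool) (b : Bool)
    (x : Fin n → Bool) :
    replacePrefix (r + 1) (Fin.snoc z b : Fin (r + 1) → Bool) x =
      replacePrefix r z (Function.update x ⟨r, hr⟩ b) := by
  funext j
  rcases lt_trichotomy j.val r with h | h | h
  · simp [replacePrefix, h, Nat.lt_succ_of_lt h, Fin.snoc]
  · obtain rfl : j = ⟨r, hr⟩ := Fin.ext h
    simp [replacePrefix, Fin.snoc]
  · have hne : j ≠ ⟨r, hr⟩ := fun e => by simp [e] at h
    simp [replacePrefix, not_lt.mpr h.le, not_lt.mpr (Nat.succ_le_of_lt h), hne]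

/-- The average of the codewords of all strings that agree with `x` from position `r` on. -/
noncomputable def prefixAverage {n d : ℕ} (f : (Fin n → Bool) → Matrix (Fin d) (Fin d) ℂ)
    (r : ℕ) (x : Fin n → Bool) : Matrix (Fin d) (Fin d) ℂ :=
  ((2 : ℂ) ^ r)⁻¹ • ∑ z : Fin r → Bool, f (replacePrefix r z x)

lemma prefixAverage_zero {n d : ℕ} (f : (Fin n → Bool) → Matrix (Fin d) (Fin d) ℂ)
    (x : Fin n → Bool) : prefixAverage f 0 x = f x := by
  have h (z : Fin 0 → Bool) : replacePrefix 0 z x = x := by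
    funext j; simp [replacePrefix]
  simp [prefixAverage, h]

lemma prefixAverage_succ {n d : ℕ} (f : (Fin n → Bool) → Matrix (Fin d) (Fin d) ℂ)
    {r : ℕ} (hr : r < n) (x : Fin n → Bool) :
    prefixAverage f (r + 1) x =
      (2 : ℂ)⁻¹ • (prefixAverage f r (Function.update x ⟨r, hr⟩ false) +
        prefixAverage f r (Function.update x ⟨r, hr⟩ true)) := by
  simp only [prefixAverage]
  rw [← smul_add, smul_smul, ← mul_inv, ← pow_succ']
  congr 1
  rw [← (Fin.snocEquiv fun _ : Fin (r + 1) => Bool).sum_comp, Fintype.sum_prod_type,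
    Fintype.sum_bool, add_comm]
  simp only [← replacePrefix_snoc hr]
  rfl

lemma prefixAverage_isDensityMatrix {n d : ℕ} {f : (Fin n → Bool) → Matrix (Fin d) (Fin d) ℂ}
    (hf : ∀ x, IsDensityMatrix (f x)) (r : ℕ) (hr : r ≤ n) (x : Fin n → Bool) :
    IsDensityMatrix (prefixAverage f r x) := by
  induction r generalizing x with
  | zero => rw [prefixAverage_zero]; exact hf x
  | succ r ih =>
    rw [prefixAverage_succ f hr]
    exact (ih (by omega) _).midpoint (ih (by omega) _)

lemma le_trace_mul_prefixAverage {n d : ℕ} {f : (Fin n → Bool) → Matrix (Fin d) (Fin d) ℂ}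
    {M : Matrix (Fin d) (Fin d) ℂ} {p : ℝ} {r : ℕ} {x : Fin n → Bool}
    (h : ∀ z, p ≤ (M * f (replacePrefix r z x)).trace.re) :
    p ≤ (M * prefixAverage f r x).trace.re := by
  have e : (M * prefixAverage f r x).trace.re =
      ((2 : ℝ) ^ r)⁻¹ * ∑ z, (M * f (replacePrefix r z x)).trace.re := by
    rw [prefixAverage, Matrix.mul_smul, trace_smul, Matrix.mul_sum, trace_sum, smul_eq_mul,
      show ((2 : ℂ) ^ r)⁻¹ = ((((2 : ℝ) ^ r)⁻¹ : ℝ) : ℂ) by push_cast; rfl,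
      Complex.re_ofReal_mul, Complex.re_sum]
  have hc := Finset.card_nsmul_le_sum Finset.univ _ p fun z _ => h z
  rw [e, le_inv_mul_iff₀ (by positivity)]
  simpa using hc

lemma suffixAfter_replacePrefix_update {n r : ℕ} (hr : r < n) (z : Fin r → Bool) (b : Bool)
    (x : Fin n → Bool) :
    suffixAfter (replacePrefix r z (Function.update x ⟨r, hr⟩ b)) ⟨r, hr⟩ =
      suffixAfter x ⟨r, hr⟩ := by
  funext j
  have h1 : ¬ r + 1 + j.val < r := by omega
  have h2 : r + 1 + j.val ≠ r := by omega
  simp [suffixAfter, replacePrefix, h1, Function.update, h2]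

lemma replacePrefix_update_apply {n r : ℕ} (hr : r < n) (z : Fin r → Bool) (b : Bool)
    (x : Fin n → Bool) :
    replacePrefix r z (Function.update x ⟨r, hr⟩ b) ⟨r, hr⟩ = b := by
  simp [replacePrefix]

lemma concatBits_eq_replacePrefix {n k : ℕ} (hk : k ≤ n) (z z' : Fin (n - k) → Bool)
    (y : Fin k → Bool) :
    concatBits hk z y = replacePrefix (n - k) z (concatBits hk z' y) := by
  funext j
  by_cases h : j.val < n - k <;> simp [concatBits, replacePrefix, h]

/-- The Claim in Section 4.4: in an `(n,m,p)`-serial encoding, the average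
`ρ_y = 2^{−(n−k)} Σ_{z ∈ {0,1}^{n−k}} f(zy)` of the codewords with suffix `y ∈ {0,1}^k`
has von Neumann entropy at least `(1 − H(p))·(n − k)`. -/
theorem entropy_of_averaged_codewords (n m : ℕ) (p : ℝ) (hp : 1 / 2 ≤ p) (hp1 : p ≤ 1)
    (f : (Fin n → Bool) → Matrix (Fin (2 ^ m)) (Fin (2 ^ m)) ℂ)
    (hf : ∀ x, IsDensityMatrix (f x))
    (E : (i : Fin n) → (Fin (n - 1 - i.val) → Bool) → Matrix (Fin (2 ^ m)) (Fin (2 ^ m)) ℂ)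
    (hE : ∀ i s, (E i s).PosSemidef ∧ (1 - E i s).PosSemidef)
    (hmeas : ∀ (x : Fin n → Bool) (i : Fin n),
      (x i = true → p ≤ ((E i (suffixAfter x i) * f x).trace).re) ∧
      (x i = false → p ≤ (((1 - E i (suffixAfter x i)) * f x).trace).re)) :
    ∀ (k : ℕ) (hk : k ≤ n) (y : Fin k → Bool),
      vnEntropy (((2 : ℂ) ^ (n - k))⁻¹ • ∑ z : Fin (n - k) → Bool, f (concatBits hk z y)) ≥
        (1 - binH p) * ((n - k : ℕ) : ℝ) := by
  intro k hk y
  have main : ∀ r ≤ n, ∀ x : Fin n → Bool,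
      (1 - binH p) * (r : ℝ) ≤ vnEntropy (prefixAverage f r x) := by
    intro r
    induction r with
    | zero =>
      intro hr x
      rw [Nat.cast_zero, mul_zero]
      exact vnEntropy_nonneg (prefixAverage_isDensityMatrix hf 0 hr x)
    | succ r ih =>
      intro hr x
      have hr' : r < n := hr
      have step := vnEntropy_midpoint_ge hp hp1
        (prefixAverage_isDensityMatrix hf r hr'.le (Function.update x ⟨r, hr'⟩ false))
        (prefixAverage_isDensityMatrix hf r hr'.le (Function.update x ⟨r, hr'⟩ true))
        (hE ⟨r, hr'⟩ (suffixAfter x ⟨r, hr'⟩)).1 (hE ⟨r, hr'⟩ (suffixAfter x ⟨r, hr'⟩)).2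
        (le_trace_mul_prefixAverage fun z => by
          rw [← suffixAfter_replacePrefix_update hr' z true x]
          exact (hmeas _ _).1 (replacePrefix_update_apply hr' z true x))
        (le_trace_mul_prefixAverage fun z => by
          rw [← suffixAfter_replacePrefix_update hr' z false x]
          exact (hmeas _ _).2 (replacePrefix_update_apply hr' z false x))
      have ih₀ := ih hr'.le (Function.update x ⟨r, hr'⟩ false)
      have ih₁ := ih hr'.le (Function.update x ⟨r, hr'⟩ true)
      rw [prefixAverage_succ f hr']
      push_cast
      linarith
  have e : ((2 : ℂ) ^ (n - k))⁻¹ • ∑ z : Fin (n - k) → Bool, f (concatBits hk z y) =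
      prefixAverage f (n - k) (concatBits hk (fun _ => false) y) := by
    rw [prefixAverage]
    simp only [← concatBits_eq_replacePrefix]
  rw [e]
  exact main (n - k) (Nat.sub_le n k) _
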